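/- Let Ω ⊂ ℝⁿ be a bounded John domain with n ≥ 3, let 1 < p, q < ∞ with 1/p + 1/q = 1, β ≥ 0, and let {Ω_t}_{t∈Γ} be a collection of extended Whitney cubes of Ω. Then the subspace S := W₀ ⊕ ρ^{pβ}V is dense in L^q(Ω, ℝ^{n×n}, ρ^{−β}). -/

import Mathlib

open MeasureTheory Metric Set Matrix
open scoped BigOperators ENNReal

noncomputable section

abbrev Euc (n : ℕ) := EuclideanSpace ℝ (Fin n)

/-- Differential matrix `(Dv)_{ij} = ∂v_i/∂x_j` (computed via the Fréchet derivative). -/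
def Dmat {n : ℕ} (v : Euc n → Euc n) (x : Euc n) : Matrix (Fin n) (Fin n) ℝ :=
  fun i j => fderiv ℝ v x (EuclideanSpace.single j 1) i

/-- Symmetric part of the differential matrix. -/
def epsMat {n : ℕ} (v : Euc n → Euc n) (x : Euc n) : Matrix (Fin n) (Fin n) ℝ :=
  (1 / 2 : ℝ) • (Dmat v x + (Dmat v x)ᵀ)

/-- Trace-free part of the symmetric part of the differential matrix. -/
def lMat {n : ℕ} (v : Euc n → Euc n) (x : Euc n) : Matrix (Fin n) (Fin n) ℝ :=
  epsMat v x - (Matrix.trace (Dmat v x) / (n : ℝ)) • (1 : Matrix (Fin n) (Fin n) ℝ)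

/-- Frobenius (Euclidean) norm of a matrix. -/
def matNorm {n : ℕ} (M : Matrix (Fin n) (Fin n) ℝ) : ℝ :=
  Real.sqrt (∑ i, ∑ j, (M i j) ^ 2)

/-- `M : N = Σ_{ij} M_{ij} N_{ij}`. -/
def matDot {n : ℕ} (M N : Matrix (Fin n) (Fin n) ℝ) : ℝ := ∑ i, ∑ j, M i j * N i j

/-- Distance to the boundary of `Ω`. -/
def distBd {n : ℕ} (Ω : Set (Euc n)) (x : Euc n) : ℝ := Metric.infDist x (frontier Ω)

/-- Open axis-parallel cube with center `c` and side length `h`. -/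
def openCube {n : ℕ} (c : Euc n) (h : ℝ) : Set (Euc n) := {x | ∀ i, |x i - c i| < h / 2}

/-- Closed axis-parallel cube with center `c` and side length `h`. -/
def closedCube {n : ℕ} (c : Euc n) (h : ℝ) : Set (Euc n) := {x | ∀ i, |x i - c i| ≤ h / 2}

/-- Bounded John domain: there are `C > 1` and a distinguished point `x₀ ∈ Ω` such that
every point of `Ω` is joined to `x₀` by a rectifiable curve, parameterized by arc length
(hence 1-Lipschitz), along which the distance to the boundary grows linearly. -/
def IsJohnDomain {n : ℕ} (Ω : Set (Euc n)) : Prop :=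
  ∃ C > (1 : ℝ), ∃ x₀ ∈ Ω, ∀ y ∈ Ω, ∃ L : ℝ, 0 ≤ L ∧ ∃ γ : ℝ → Euc n,
    γ 0 = y ∧ γ L = x₀ ∧ (∀ t ∈ Icc 0 L, γ t ∈ Ω) ∧
    (∀ s ∈ Icc 0 L, ∀ t ∈ Icc 0 L, dist (γ s) (γ t) ≤ |s - t|) ∧
    (∀ t ∈ Icc 0 L, t / C ≤ Metric.infDist (γ t) (frontier Ω))

/-- The matrix-valued functions `H_i`. -/
def Hmat {n : ℕ} (i : Fin n) (z : Euc n) : Matrix (Fin n) (Fin n) ℝ :=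
  fun j k => if j = k then z i else if k = i then z j else if j = i then -z k else 0

/-- The finite-dimensional space `V = D(Σ)`:
`φ(x) = A + λ I + Σ_i b_i H_i(x − y)` with `A` skew-symmetric. -/
def Vset (n : ℕ) : Set (Euc n → Matrix (Fin n) (Fin n) ℝ) :=
  {φ | ∃ (A : Matrix (Fin n) (Fin n) ℝ) (lam : ℝ) (b : Fin n → ℝ) (y : Euc n),
    Aᵀ = -A ∧ ∀ x, φ x = A + lam • (1 : Matrix (Fin n) (Fin n) ℝ) + ∑ i, b i • Hmat i (x - y)}


/-- A Whitney decomposition of `Ω`: closed dyadic axis-parallel cubes `Q_t` with pairwise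
disjoint interiors covering `Ω`, with `diam(Q_t) ≤ dist(Q_t, ∂Ω) ≤ 4 diam(Q_t)` and
comparable diameters (within a factor 4) for touching cubes. -/
structure WhitneyDecomp (n : ℕ) (Ω : Set (Euc n)) (Γ : Type) where
  c : Γ → Euc n
  s : Γ → ℝ
  s_pos : ∀ t, 0 < s t
  dyadic : ∀ t, ∃ k : ℤ, s t = (2 : ℝ) ^ k ∧
    ∀ i, ∃ m : ℤ, c t i = (m : ℝ) * (2 : ℝ) ^ k + (2 : ℝ) ^ k / 2
  interior_disj : Pairwise fun t t' =>
    interior (closedCube (c t) (s t)) ∩ interior (closedCube (c t') (s t')) = ∅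
  cover : (⋃ t, closedCube (c t) (s t)) = Ω
  diam_le_dist : ∀ t, ∀ x ∈ closedCube (c t) (s t),
    Metric.diam (closedCube (c t) (s t)) ≤ Metric.infDist x (frontier Ω)
  dist_le_diam : ∀ t, ∃ x ∈ closedCube (c t) (s t),
    Metric.infDist x (frontier Ω) ≤ 4 * Metric.diam (closedCube (c t) (s t))
  nbr_comparable : ∀ t t', (closedCube (c t) (s t) ∩ closedCube (c t') (s t')).Nonempty →
    Metric.diam (closedCube (c t) (s t)) ≤ 4 * Metric.diam (closedCube (c t') (s t'))

/-- The extended (open) Whitney cube `Ω_t = (9/8) Q_t°`. -/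
def extCube {n : ℕ} {Ω : Set (Euc n)} {Γ : Type} (wd : WhitneyDecomp n Ω Γ) (t : Γ) :
    Set (Euc n) :=
  openCube (wd.c t) (9 / 8 * wd.s t)

/-- A closed `(n−1)`-dimensional face of the cube with center `c` and side `h`. -/
def cubeFace {n : ℕ} (c : Euc n) (h : ℝ) (i : Fin n) (σ : Bool) : Set (Euc n) :=
  {x ∈ closedCube c h | x i = c i + (if σ then h / 2 else -(h / 2))}

/-- Two axis-parallel cubes are `(n−1)`-neighbors when their intersection is an
`(n−1)`-dimensional face of one of them. -/
def IsFaceNeighbor {n : ℕ} (c₁ : Euc n) (h₁ : ℝ) (c₂ : Euc n) (h₂ : ℝ) : Prop :=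
  ∃ i σ, closedCube c₁ h₁ ∩ closedCube c₂ h₂ = cubeFace c₁ h₁ i σ ∨
    closedCube c₁ h₁ ∩ closedCube c₂ h₂ = cubeFace c₂ h₂ i σ

/-- A tree structure on the index set `Γ` of a Whitney decomposition: a root and a parent
map reaching the root in finitely many steps, whose edges join `(n−1)`-neighbor cubes. -/
structure TreeStruct {n : ℕ} {Ω : Set (Euc n)} {Γ : Type} (wd : WhitneyDecomp n Ω Γ) where
  root : Γ
  parent : Γ → Γ
  parent_root : parent root = root
  reaches_root : ∀ t, ∃ k : ℕ, parent^[k] t = root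
  parent_nbr : ∀ t, t ≠ root →
    IsFaceNeighbor (wd.c t) (wd.s t) (wd.c (parent t)) (wd.s (parent t))

/-- The induced partial order: `s ⪯ t` iff the path from `t` to the root passes
through `s`, i.e. `s` is obtained from `t` by iterating the parent map. -/
def treeLE {n : ℕ} {Ω : Set (Euc n)} {Γ : Type} {wd : WhitneyDecomp n Ω Γ}
    (T : TreeStruct wd) (s t : Γ) : Prop :=
  ∃ k : ℕ, T.parent^[k] t = s

/-- The shadow `W_t = ⋃_{s ⪰ t} Ω_s` of the extended cube `Ω_t`. -/
def shadow {n : ℕ} {Ω : Set (Euc n)} {Γ : Type} {wd : WhitneyDecomp n Ω Γ}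
    (T : TreeStruct wd) (t : Γ) : Set (Euc n) :=
  ⋃ (s : Γ) (_ : treeLE T t s), extCube wd s

open Classical in
/-- The Hardy type operator `Tg(x) = Σ_{t ≠ a} (χ_{B_t}(x)/|W_t|) ∫_{W_t} |g|`, for a
family of cubes `B_t = openCube (Bc t) (Bh t)`. -/
def hardyT {n : ℕ} {Ω : Set (Euc n)} {Γ : Type} {wd : WhitneyDecomp n Ω Γ}
    (T : TreeStruct wd) (Bc : Γ → Euc n) (Bh : Γ → ℝ) (u : Euc n → ℝ) (x : Euc n) : ℝ :=
  ∑ᶠ t : Γ, if t = T.root then 0 else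
    Set.indicator (openCube (Bc t) (Bh t))
      (fun _ => (∫ y in shadow T t, |u y|) / (volume (shadow T t)).toReal) x

/-- Membership in `W ⊆ L^q(Ω, ℝ^{n×n}, ρ^{−β})`: a (weighted-`q`-integrable, hence
integrable) matrix field orthogonal to every element of `V`. -/
def memW {n : ℕ} (Ω : Set (Euc n)) (q β : ℝ)
    (g : Euc n → Matrix (Fin n) (Fin n) ℝ) : Prop :=
  AEStronglyMeasurable g (volume.restrict Ω) ∧
  IntegrableOn (fun x => matNorm (g x)) Ω ∧
  IntegrableOn (fun x => matNorm (g x) ^ q * distBd Ω x ^ (-(q * β))) Ω ∧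
  ∀ φ ∈ Vset n, ∫ x in Ω, matDot (g x) (φ x) = 0

/-- Membership in `W₀`: elements of `W` whose support meets only finitely many of the
extended Whitney cubes. -/
def memW0 {n : ℕ} {Ω : Set (Euc n)} {Γ : Type} (q β : ℝ) (wd : WhitneyDecomp n Ω Γ)
    (g : Euc n → Matrix (Fin n) (Fin n) ℝ) : Prop :=
  memW Ω q β g ∧ {t : Γ | (Function.support g ∩ extCube wd t).Nonempty}.Finite

instance {n : ℕ} : TopologicalSpace.PseudoMetrizableSpace (Matrix (Fin n) (Fin n) ℝ) :=
  inferInstanceAs (TopologicalSpace.PseudoMetrizableSpace (Fin n → Fin n → ℝ))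

lemma matNorm_nonneg {n : ℕ} (M : Matrix (Fin n) (Fin n) ℝ) : 0 ≤ matNorm M :=
  Real.sqrt_nonneg _

lemma matNorm_zero {n : ℕ} : matNorm (0 : Matrix (Fin n) (Fin n) ℝ) = 0 := by
  simp [matNorm]

lemma continuous_matNorm {n : ℕ} :
    Continuous (matNorm : Matrix (Fin n) (Fin n) ℝ → ℝ) := by
  unfold matNorm
  fun_prop

section Frobenius

attribute [local instance] Matrix.frobeniusNormedAddCommGroup Matrix.frobeniusNormedSpace

lemma matNorm_eq_norm {n : ℕ} (M : Matrix (Fin n) (Fin n) ℝ) : matNorm M = ‖M‖ := by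
  rw [Matrix.frobenius_norm_def, matNorm, Real.sqrt_eq_rpow]
  simp

lemma matNorm_sub_le {n : ℕ} (M N : Matrix (Fin n) (Fin n) ℝ) :
    matNorm (M - N) ≤ matNorm M + matNorm N := by
  simpa only [matNorm_eq_norm] using norm_sub_le M N

lemma matNorm_sum_le {n : ℕ} {ι : Type*} (s : Finset ι) (M : ι → Matrix (Fin n) (Fin n) ℝ) :
    matNorm (∑ j ∈ s, M j) ≤ ∑ j ∈ s, matNorm (M j) := by
  simpa only [matNorm_eq_norm] using norm_sum_le s M

lemma matNorm_smul {n : ℕ} (a : ℝ) (M : Matrix (Fin n) (Fin n) ℝ) :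
    matNorm (a • M) = |a| * matNorm M := by
  simpa only [matNorm_eq_norm, Real.norm_eq_abs] using norm_smul a M

end Frobenius

lemma matDot_add_left {n : ℕ} (M M' N : Matrix (Fin n) (Fin n) ℝ) :
    matDot (M + M') N = matDot M N + matDot M' N := by
  simp [matDot, add_mul, Finset.sum_add_distrib]

lemma matDot_sub_left {n : ℕ} (M M' N : Matrix (Fin n) (Fin n) ℝ) :
    matDot (M - M') N = matDot M N - matDot M' N := by
  simp [matDot, sub_mul, Finset.sum_sub_distrib]

lemma matDot_smul_left {n : ℕ} (a : ℝ) (M N : Matrix (Fin n) (Fin n) ℝ) :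
    matDot (a • M) N = a * matDot M N := by
  simp [matDot, Finset.mul_sum, mul_assoc]

lemma matDot_comm {n : ℕ} (M N : Matrix (Fin n) (Fin n) ℝ) : matDot M N = matDot N M := by
  simp [matDot, mul_comm]

lemma matDot_self {n : ℕ} (M : Matrix (Fin n) (Fin n) ℝ) : matDot M M = matNorm M ^ 2 := by
  have h : 0 ≤ ∑ i, ∑ j, M i j ^ 2 := by positivity
  calc matDot M M = ∑ i, ∑ j, M i j ^ 2 := by simp [matDot, sq]
    _ = matNorm M ^ 2 := (Real.sq_sqrt h).symm

lemma abs_matDot_le {n : ℕ} (M N : Matrix (Fin n) (Fin n) ℝ) :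
    |matDot M N| ≤ matNorm M * matNorm N := by
  have h := Finset.sum_mul_sq_le_sq_mul_sq (Finset.univ : Finset (Fin n × Fin n))
    (fun z => M z.1 z.2) (fun z => N z.1 z.2)
  simp only [Fintype.sum_prod_type] at h
  have h' : matDot M N ^ 2 ≤ matDot M M * matDot N N := by
    simpa only [matDot, sq] using h
  rw [matDot_self, matDot_self, ← mul_pow] at h'
  exact abs_le_of_sq_le_sq h' (mul_nonneg (matNorm_nonneg _) (matNorm_nonneg _))

lemma matNorm_eq_zero {n : ℕ} {M : Matrix (Fin n) (Fin n) ℝ} (h : matNorm M = 0) : M = 0 := by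
  let _ : NormedAddCommGroup (Matrix (Fin n) (Fin n) ℝ) := Matrix.frobeniusNormedAddCommGroup
  rw [matNorm_eq_norm] at h
  exact norm_eq_zero.mp h

lemma continuous_matDot {n : ℕ} :
    Continuous fun z : Matrix (Fin n) (Fin n) ℝ × Matrix (Fin n) (Fin n) ℝ =>
      matDot z.1 z.2 := by
  unfold matDot
  fun_prop

lemma Hmat_add {n : ℕ} (i : Fin n) (x y : Euc n) : Hmat i (x + y) = Hmat i x + Hmat i y := by
  ext j k
  simp only [Hmat, Matrix.add_apply, PiLp.add_apply]
  split_ifs <;> ring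

lemma Hmat_smul {n : ℕ} (i : Fin n) (a : ℝ) (x : Euc n) : Hmat i (a • x) = a • Hmat i x := by
  ext j k
  simp only [Hmat, Matrix.smul_apply, PiLp.smul_apply, smul_eq_mul]
  split_ifs <;> ring

lemma Hmat_sub {n : ℕ} (i : Fin n) (x y : Euc n) : Hmat i (x - y) = Hmat i x - Hmat i y := by
  ext j k
  simp only [Hmat, Matrix.sub_apply, PiLp.sub_apply]
  split_ifs <;> ring

lemma Hmat_skew {n : ℕ} (i : Fin n) (y : Euc n) :
    (Hmat i y - y i • (1 : Matrix (Fin n) (Fin n) ℝ))ᵀ =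
      -(Hmat i y - y i • (1 : Matrix (Fin n) (Fin n) ℝ)) := by
  ext j k
  by_cases hjk : j = k
  · subst hjk; simp [Hmat]
  · have hkj : k ≠ j := fun h => hjk h.symm
    by_cases hj : j = i <;> by_cases hk : k = i
    · exact absurd (hj.trans hk.symm) hjk
    all_goals simp [Hmat, hjk, hkj, hj, hk, Matrix.one_apply]
    all_goals aesop

lemma continuous_Hmat {n : ℕ} (i : Fin n) : Continuous (Hmat i : Euc n → _) := by
  refine continuous_matrix fun j k => ?_
  simp only [Hmat]
  split_ifs <;> fun_prop

/-- The subspace of skew-symmetric matrices. -/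
def skewSubmodule (n : ℕ) : Submodule ℝ (Matrix (Fin n) (Fin n) ℝ) where
  carrier := {A | Aᵀ = -A}
  add_mem' {A B} hA hB := by
    simp only [mem_ofPred_eq] at *
    rw [Matrix.transpose_add, hA, hB]; abel
  zero_mem' := by simp
  smul_mem' a A hA := by
    simp only [mem_ofPred_eq] at *
    rw [Matrix.transpose_smul, hA, smul_neg]

/-- The linear parametrization of `V`. -/
def Vmap (n : ℕ) :
    (skewSubmodule n × ℝ × (Fin n → ℝ)) →ₗ[ℝ] (Euc n → Matrix (Fin n) (Fin n) ℝ) where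
  toFun P x := P.1 + P.2.1 • (1 : Matrix (Fin n) (Fin n) ℝ) + ∑ i, P.2.2 i • Hmat i x
  map_add' P R := by
    ext1 x
    simp only [Prod.fst_add, Prod.snd_add, Submodule.coe_add, add_smul, Pi.add_apply,
      Finset.sum_add_distrib]
    abel
  map_smul' a P := by
    ext1 x
    simp [smul_add, Finset.smul_sum, mul_smul]

/-- The space `V` as a subspace of the space of all matrix fields. -/
def Vsub (n : ℕ) : Submodule ℝ (Euc n → Matrix (Fin n) (Fin n) ℝ) := LinearMap.range (Vmap n)

instance (n : ℕ) : FiniteDimensional ℝ (Vsub n) := by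
  unfold Vsub
  infer_instance

lemma mem_Vsub_iff {n : ℕ} {φ : Euc n → Matrix (Fin n) (Fin n) ℝ} :
    φ ∈ Vsub n ↔ φ ∈ Vset n := by
  constructor
  · rintro ⟨⟨A, lam, b⟩, rfl⟩
    exact ⟨A, lam, b, 0, A.2, fun x => by simp [Vmap]⟩
  · rintro ⟨A, lam, b, y, hA, hφ⟩
    have hS : A - ∑ i, b i • (Hmat i y - y i • (1 : Matrix (Fin n) (Fin n) ℝ)) ∈
        skewSubmodule n :=
      (skewSubmodule n).sub_mem hA
        ((skewSubmodule n).sum_mem fun i _ => (skewSubmodule n).smul_mem _ (Hmat_skew i y))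
    refine ⟨⟨⟨_, hS⟩, lam - ∑ i, b i * y i, b⟩, ?_⟩
    ext1 x
    rw [hφ x]
    simp only [Vmap, LinearMap.coe_mk, AddHom.coe_mk, Hmat_sub, smul_sub, sub_smul,
      Finset.sum_sub_distrib, Finset.sum_smul, mul_smul]
    abel

lemma continuous_of_mem_Vsub {n : ℕ} {φ : Euc n → Matrix (Fin n) (Fin n) ℝ}
    (hφ : φ ∈ Vsub n) : Continuous φ := by
  obtain ⟨P, rfl⟩ := hφ
  simp only [Vmap, LinearMap.coe_mk, AddHom.coe_mk]
  have := fun i : Fin n => continuous_Hmat i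
  fun_prop

lemma affine_of_mem_Vsub {n : ℕ} {φ : Euc n → Matrix (Fin n) (Fin n) ℝ}
    (hφ : φ ∈ Vsub n) (x z : Euc n) (t : ℝ) :
    φ (x + t • z) = φ x + t • (φ (x + z) - φ x) := by
  obtain ⟨P, rfl⟩ := hφ
  simp only [Vmap, LinearMap.coe_mk, AddHom.coe_mk, Hmat_add, Hmat_smul, smul_add,
    Finset.sum_add_distrib, smul_sub, Finset.smul_sum]
  simp only [smul_comm t]
  abel

lemma eq_zero_of_mem_Vsub {n : ℕ} {φ : Euc n → Matrix (Fin n) (Fin n) ℝ}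
    (hφ : φ ∈ Vsub n) {U : Set (Euc n)} (hU : IsOpen U) (hne : U.Nonempty)
    (h : ∀ x ∈ U, φ x = 0) : φ = 0 := by
  obtain ⟨x, hx⟩ := hne
  ext1 y
  have hc : Filter.Tendsto (fun t : ℝ => x + t • (y - x)) (nhdsWithin 0 {0}ᶜ) (nhds x) := by
    have : Continuous fun t : ℝ => x + t • (y - x) := by fun_prop
    have h0 := this.tendsto 0
    simp only [zero_smul, add_zero] at h0
    exact h0.mono_left nhdsWithin_le_nhds
  obtain ⟨t, htU, ht0⟩ :=
    ((hc.eventually (hU.mem_nhds hx)).and self_mem_nhdsWithin).exists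
  have e := affine_of_mem_Vsub hφ x (y - x) t
  rw [h _ htU, h x hx, add_sub_cancel, zero_add, sub_zero] at e
  simpa using (smul_eq_zero.mp e.symm).resolve_left ht0

lemma exists_matNorm_le_of_mem_Vsub {n : ℕ} {φ : Euc n → Matrix (Fin n) (Fin n) ℝ}
    (hφ : φ ∈ Vsub n) {Ω : Set (Euc n)} (hΩ : Bornology.IsBounded Ω) :
    ∃ C, 0 ≤ C ∧ ∀ x ∈ Ω, matNorm (φ x) ≤ C := by
  obtain ⟨C, hC⟩ := hΩ.isCompact_closure.exists_bound_of_continuousOn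
    (continuous_matNorm.comp (continuous_of_mem_Vsub hφ)).continuousOn
  refine ⟨max C 0, le_max_right _ _, fun x hx => ?_⟩
  exact (le_abs_self _).trans ((hC x (subset_closure hx)).trans (le_max_left _ _))

lemma integrableOn_matDot {n : ℕ} {Ω : Set (Euc n)} (hΩo : IsOpen Ω)
    (hΩb : Bornology.IsBounded Ω) {G φ : Euc n → Matrix (Fin n) (Fin n) ℝ}
    (hG : AEStronglyMeasurable G (volume.restrict Ω))
    (hGi : IntegrableOn (fun x => matNorm (G x)) Ω) (hφ : φ ∈ Vsub n) :
    IntegrableOn (fun x => matDot (G x) (φ x)) Ω := by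
  obtain ⟨C, hC0, hC⟩ := exists_matNorm_le_of_mem_Vsub hφ hΩb
  have hm : AEStronglyMeasurable (fun x => matDot (G x) (φ x)) (volume.restrict Ω) := by
    unfold matDot
    refine Finset.aestronglyMeasurable_fun_sum _ fun i _ =>
      Finset.aestronglyMeasurable_fun_sum _ fun j _ => ?_
    exact ((continuous_id.matrix_elem i j).comp_aestronglyMeasurable hG).mul
      ((continuous_of_mem_Vsub hφ).matrix_elem i j).aestronglyMeasurable
  refine Integrable.mono' (hGi.mul_const C) hm ?_
  filter_upwards [ae_restrict_mem hΩo.measurableSet] with x hx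
  exact (abs_matDot_le _ _).trans (mul_le_mul_of_nonneg_left (hC x hx) (matNorm_nonneg _))

lemma integrableOn_of_bound {n : ℕ} {Ω : Set (Euc n)} (hΩo : IsOpen Ω)
    (hΩb : Bornology.IsBounded Ω) {f : Euc n → ℝ}
    (hf : AEStronglyMeasurable f (volume.restrict Ω)) (C : ℝ) (hC : ∀ x ∈ Ω, |f x| ≤ C) :
    IntegrableOn f Ω := by
  have : IsFiniteMeasure (volume.restrict Ω) := ⟨by simpa using hΩb.measure_lt_top⟩
  refine (integrable_const C).mono' hf ?_
  filter_upwards [ae_restrict_mem hΩo.measurableSet] with x hx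
  exact hC x hx

lemma exists_weighted_representation_map {n : ℕ} {Ω U : Set (Euc n)} (hΩo : IsOpen Ω)
    (hΩb : Bornology.IsBounded Ω) (hU : IsOpen U) (hne : U.Nonempty) (hUΩ : U ⊆ Ω)
    {w : Euc n → ℝ} (hw : AEStronglyMeasurable w (volume.restrict Ω)) (C : ℝ)
    (hw0 : ∀ x ∈ Ω, 0 ≤ w x) (hwC : ∀ x ∈ Ω, w x ≤ C) (hwU : ∀ x ∈ U, 0 < w x) :
    ∃ T : Module.Dual ℝ (Vsub n) →ₗ[ℝ] Vsub n, ∀ (ℓ : Module.Dual ℝ (Vsub n)) (φ : Vsub n),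
      ∫ x in Ω, w x * matDot ((T ℓ).1 x) (φ.1 x) = ℓ φ := by
  have hint : ∀ v φ : Vsub n,
      IntegrableOn (fun x => w x * matDot (v.1 x) (φ.1 x)) Ω := by
    intro v φ
    obtain ⟨A, hA0, hA⟩ := exists_matNorm_le_of_mem_Vsub v.2 hΩb
    obtain ⟨B, hB0, hB⟩ := exists_matNorm_le_of_mem_Vsub φ.2 hΩb
    refine integrableOn_of_bound hΩo hΩb (hw.mul (continuous_matDot.comp
      ((continuous_of_mem_Vsub v.2).prodMk
        (continuous_of_mem_Vsub φ.2))).aestronglyMeasurable) (C * (A * B)) fun x hx => ?_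
    rw [abs_mul, abs_of_nonneg (hw0 x hx)]
    refine mul_le_mul (hwC x hx) ((abs_matDot_le _ _).trans
      (mul_le_mul (hA x hx) (hB x hx) (matNorm_nonneg _) hA0)) (abs_nonneg _)
      ((hw0 x hx).trans (hwC x hx))
  let B : Vsub n →ₗ[ℝ] Module.Dual ℝ (Vsub n) := LinearMap.mk₂ ℝ
    (fun v φ => ∫ x in Ω, w x * matDot (v.1 x) (φ.1 x))
    (fun v v' φ => by
      rw [← integral_add (hint v φ) (hint v' φ)]
      refine integral_congr_ae (.of_forall fun x => ?_)
      simp only [Submodule.coe_add, Pi.add_apply, matDot_add_left]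
      ring)
    (fun a v φ => by
      rw [smul_eq_mul, ← integral_const_mul]
      refine integral_congr_ae (.of_forall fun x => ?_)
      simp only [Submodule.coe_smul, Pi.smul_apply, matDot_smul_left]
      ring)
    (fun v φ φ' => by
      rw [← integral_add (hint v φ) (hint v φ')]
      refine integral_congr_ae (.of_forall fun x => ?_)
      simp only [Submodule.coe_add, Pi.add_apply, matDot_comm (v.1 x), matDot_add_left]
      ring)
    (fun a v φ => by
      rw [smul_eq_mul, ← integral_const_mul]
      refine integral_congr_ae (.of_forall fun x => ?_)
      simp only [Submodule.coe_smul, Pi.smul_apply, matDot_comm (v.1 x), matDot_smul_left]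
      ring)
  have hB : Function.Injective B := by
    rw [injective_iff_map_eq_zero]
    intro v hv
    have h0 : ∫ x in Ω, w x * matDot (v.1 x) (v.1 x) = 0 := DFunLike.congr_fun hv v
    rw [integral_eq_zero_iff_of_nonneg_ae ?_ (hint v v)] at h0
    · have hv0 : ∀ᵐ x ∂(volume.restrict U), v.1 x = 0 := by
        filter_upwards [ae_restrict_of_ae_restrict_of_subset hUΩ h0,
          ae_restrict_mem hU.measurableSet] with x hx hxU
        have hx' : w x * matDot (v.1 x) (v.1 x) = 0 := hx
        rw [matDot_self] at hx'
        exact matNorm_eq_zero (by simpa [(hwU x hxU).ne'] using hx')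
      have hEq := Measure.eqOn_open_of_ae_eq hv0 hU
        (continuous_of_mem_Vsub v.2).continuousOn continuousOn_const
      exact Subtype.ext (eq_zero_of_mem_Vsub v.2 hU hne hEq)
    · filter_upwards [ae_restrict_mem hΩo.measurableSet] with x hx
      rw [matDot_self]
      exact mul_nonneg (hw0 x hx) (sq_nonneg _)
  let e := LinearEquiv.ofInjectiveOfFinrankEq B hB Subspace.dual_finrank_eq.symm
  exact ⟨e.symm.toLinearMap, fun ℓ φ => DFunLike.congr_fun (e.apply_symm_apply ℓ) φ⟩

lemma distBd_pos {n : ℕ} (hn : 3 ≤ n) {Ω : Set (Euc n)} (hΩo : IsOpen Ω)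
    (hΩb : Bornology.IsBounded Ω) {x : Euc n} (hx : x ∈ Ω) : 0 < distBd Ω x := by
  have : Nonempty (Fin n) := ⟨⟨0, by omega⟩⟩
  have hne : (frontier Ω).Nonempty := by
    rw [nonempty_frontier_iff]
    refine ⟨⟨x, hx⟩, ?_⟩
    rintro rfl
    exact NormedSpace.unbounded_univ ℝ (Euc n) hΩb
  refine (isClosed_frontier.notMem_iff_infDist_pos hne).mp fun h => ?_
  exact (hΩo.frontier_eq ▸ h).2 hx

lemma continuous_distBd {n : ℕ} (Ω : Set (Euc n)) : Continuous (distBd Ω) :=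
  Metric.continuous_infDist_pt _

lemma norm_le_of_abs_le {n : ℕ} {z : Euc n} {a : ℝ} (h : ∀ i, |z i| ≤ a) :
    ‖z‖ ≤ Real.sqrt n * |a| := by
  rw [EuclideanSpace.norm_eq, ← Real.sqrt_sq_eq_abs a, ← Real.sqrt_mul (Nat.cast_nonneg n)]
  refine Real.sqrt_le_sqrt ((Finset.sum_le_sum fun i _ =>
    show ‖z i‖ ^ 2 ≤ a ^ 2 from pow_le_pow_left₀ (norm_nonneg _) (h i) 2).trans ?_)
  simp

lemma diam_closedCube_le {n : ℕ} (c : Euc n) {s : ℝ} (hs : 0 ≤ s) :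
    Metric.diam (closedCube c s) ≤ Real.sqrt n * s := by
  refine Metric.diam_le_of_forall_dist_le (by positivity) fun x hx y hy => ?_
  rw [dist_eq_norm]
  refine (norm_le_of_abs_le (a := s) fun i => ?_).trans_eq (by rw [abs_of_nonneg hs])
  have h1 := abs_le.mp (hx i)
  have h2 := abs_le.mp (hy i)
  rw [PiLp.sub_apply, abs_le]
  constructor <;> linarith [h1.1, h1.2, h2.1, h2.2]

lemma distBd_le_of_mem_extCube {n : ℕ} {Ω : Set (Euc n)} {Γ : Type}
    (wd : WhitneyDecomp n Ω Γ) (t : Γ) {x : Euc n} (hx : x ∈ extCube wd t) :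
    distBd Ω x ≤ 6 * Real.sqrt n * wd.s t := by
  have hs := wd.s_pos t
  obtain ⟨y, hy, hyd⟩ := wd.dist_le_diam t
  have hdiam := diam_closedCube_le (wd.c t) hs.le
  have hxy : dist x y ≤ Real.sqrt n * (2 * wd.s t) := by
    rw [dist_eq_norm]
    refine (norm_le_of_abs_le (a := 2 * wd.s t) fun i => ?_).trans_eq
      (by rw [abs_of_nonneg (by positivity)])
    have h1 := abs_lt.mp (hx i)
    have h2 := abs_le.mp (hy i)
    rw [PiLp.sub_apply, abs_le]
    constructor <;> linarith [h1.1, h1.2, h2.1, h2.2]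
  have h := Metric.infDist_le_infDist_add_dist (s := frontier Ω) (x := x) (y := y)
  unfold distBd
  nlinarith

lemma finite_extCube_of_le_distBd {n : ℕ} {Ω : Set (Euc n)}
    (hΩb : Bornology.IsBounded Ω) {Γ : Type} (wd : WhitneyDecomp n Ω Γ) {δ : ℝ} (hδ : 0 < δ)
    {S : Set (Euc n)} (hS : ∀ x ∈ S, δ ≤ distBd Ω x) :
    {t : Γ | (S ∩ extCube wd t).Nonempty}.Finite := by
  set r : ℝ := δ / (6 * Real.sqrt n + 1) / 2 with hr
  have hr0 : 0 < r := by positivity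
  have hball : ∀ t, ball (wd.c t) (wd.s t / 2) ⊆ closedCube (wd.c t) (wd.s t) := by
    intro t x hx i
    rw [mem_ball, dist_eq_norm] at hx
    exact (PiLp.norm_apply_le (x - wd.c t) i).trans hx.le
  have hfin := Measure.finite_const_le_meas_of_disjoint_iUnion (volume : Measure (Euc n))
    (ε := volume (ball (0 : Euc n) r)) (measure_ball_pos _ _ hr0)
    (As := fun t => ball (wd.c t) (wd.s t / 2)) (fun t => isOpen_ball.measurableSet)
    (fun t t' htt' => by
      rw [Function.onFun, Set.disjoint_iff_inter_eq_empty]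
      refine Set.subset_eq_empty (Set.inter_subset_inter
        (interior_maximal (hball t) isOpen_ball)
        (interior_maximal (hball t') isOpen_ball)) (wd.interior_disj htt'))
    ((measure_mono ((Set.iUnion_mono hball).trans wd.cover.subset)).trans_lt
      hΩb.measure_lt_top).ne
  refine hfin.subset ?_
  rintro t ⟨x, hxS, hxt⟩
  have h1 := (hS x hxS).trans (distBd_le_of_mem_extCube wd t hxt)
  have hs := wd.s_pos t
  have h2 : r ≤ wd.s t / 2 := by
    rw [hr]
    gcongr
    rw [div_le_iff₀ (by positivity)]
    nlinarith
  show volume (ball (0 : Euc n) r) ≤ volume (ball (wd.c t) (wd.s t / 2))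
  rw [← Measure.addHaar_ball_center volume (wd.c t) r]
  exact measure_mono (ball_subset_ball h2)

lemma rpow_add_le_two_rpow_mul {a b q : ℝ} (ha : 0 ≤ a) (hb : 0 ≤ b) (hq : 0 ≤ q) :
    (a + b) ^ q ≤ 2 ^ q * (a ^ q + b ^ q) := by
  have ha' := Real.rpow_nonneg ha q
  have hb' := Real.rpow_nonneg hb q
  rcases le_total a b with h | h
  · calc (a + b) ^ q ≤ (2 * b) ^ q := by gcongr; linarith
      _ = 2 ^ q * b ^ q := Real.mul_rpow (by norm_num) hb
      _ ≤ _ := by gcongr; linarith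
  · calc (a + b) ^ q ≤ (2 * a) ^ q := by gcongr; linarith
      _ = 2 ^ q * a ^ q := Real.mul_rpow (by norm_num) ha
      _ ≤ _ := by gcongr; linarith

/-- Membership of a matrix field in `L^q(Ω, ℝ^{n×n}, ρ^{−β})`. -/
def MemWeightedLq {n : ℕ} (Ω : Set (Euc n)) (q β : ℝ)
    (G : Euc n → Matrix (Fin n) (Fin n) ℝ) : Prop :=
  AEStronglyMeasurable G (volume.restrict Ω) ∧
    IntegrableOn (fun x => matNorm (G x) ^ q * distBd Ω x ^ (-(q * β))) Ω

lemma aestronglyMeasurable_weighted {n : ℕ} {Ω : Set (Euc n)} {q : ℝ} (β : ℝ) (hq : 0 ≤ q)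
    {G : Euc n → Matrix (Fin n) (Fin n) ℝ}
    (hG : AEStronglyMeasurable G (volume.restrict Ω)) :
    AEStronglyMeasurable (fun x => matNorm (G x) ^ q * distBd Ω x ^ (-(q * β)))
      (volume.restrict Ω) := by
  have h1 : Continuous fun M : Matrix (Fin n) (Fin n) ℝ => matNorm M ^ q :=
    continuous_matNorm.rpow_const fun _ => Or.inr hq
  exact (h1.comp_aestronglyMeasurable hG).mul
    ((continuous_distBd Ω).measurable.pow_const _).aestronglyMeasurable

lemma distBd_rpow_nonneg {n : ℕ} (Ω : Set (Euc n)) (x : Euc n) (a : ℝ) :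
    0 ≤ distBd Ω x ^ a :=
  Real.rpow_nonneg Metric.infDist_nonneg _

lemma MemWeightedLq.sub {n : ℕ} {Ω : Set (Euc n)} {q β : ℝ} (hq : 0 ≤ q)
    {G H : Euc n → Matrix (Fin n) (Fin n) ℝ} (hG : MemWeightedLq Ω q β G)
    (hH : MemWeightedLq Ω q β H) : MemWeightedLq Ω q β (G - H) := by
  refine ⟨hG.1.sub hH.1, ((hG.2.add hH.2).const_mul (2 ^ q)).mono'
    (aestronglyMeasurable_weighted β hq (hG.1.sub hH.1)) (.of_forall fun x => ?_)⟩
  have hW := distBd_rpow_nonneg Ω x (-(q * β))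
  rw [Real.norm_of_nonneg (mul_nonneg (Real.rpow_nonneg (matNorm_nonneg _) _) hW)]
  calc matNorm ((G - H) x) ^ q * distBd Ω x ^ (-(q * β))
      ≤ (2 ^ q * (matNorm (G x) ^ q + matNorm (H x) ^ q)) * distBd Ω x ^ (-(q * β)) := by
        gcongr
        exact (Real.rpow_le_rpow (matNorm_nonneg _) (matNorm_sub_le _ _) hq).trans
          (rpow_add_le_two_rpow_mul (matNorm_nonneg _) (matNorm_nonneg _) hq)
    _ = _ := by simp only [Pi.add_apply]; ring

lemma matNorm_indicator_le {n : ℕ} (S : Set (Euc n))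
    (G : Euc n → Matrix (Fin n) (Fin n) ℝ) (x : Euc n) :
    matNorm (S.indicator G x) ≤ matNorm (G x) := by
  by_cases hx : x ∈ S
  · rw [indicator_of_mem hx]
  · rw [indicator_of_notMem hx, matNorm_zero]
    exact matNorm_nonneg _

lemma MemWeightedLq.indicator {n : ℕ} {Ω : Set (Euc n)} {q β : ℝ} (hq : 0 ≤ q)
    {G : Euc n → Matrix (Fin n) (Fin n) ℝ} (hG : MemWeightedLq Ω q β G)
    {S : Set (Euc n)} (hS : MeasurableSet S) : MemWeightedLq Ω q β (S.indicator G) := by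
  refine ⟨hG.1.indicator hS, hG.2.mono'
    (aestronglyMeasurable_weighted β hq (hG.1.indicator hS)) (.of_forall fun x => ?_)⟩
  have hW := distBd_rpow_nonneg Ω x (-(q * β))
  rw [Real.norm_of_nonneg (mul_nonneg (Real.rpow_nonneg (matNorm_nonneg _) _) hW)]
  gcongr
  · exact matNorm_nonneg _
  · exact matNorm_indicator_le S G x

lemma memWeightedLq_of_bound {n : ℕ} {Ω : Set (Euc n)} (hΩo : IsOpen Ω)
    (hΩb : Bornology.IsBounded Ω) {q β : ℝ} (hq : 0 ≤ q)
    {G : Euc n → Matrix (Fin n) (Fin n) ℝ}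
    (hG : AEStronglyMeasurable G (volume.restrict Ω)) (C : ℝ)
    (hC : ∀ x ∈ Ω, matNorm (G x) ^ q * distBd Ω x ^ (-(q * β)) ≤ C) :
    MemWeightedLq Ω q β G := by
  refine ⟨hG, integrableOn_of_bound hΩo hΩb (aestronglyMeasurable_weighted β hq hG) C
    fun x hx => ?_⟩
  rw [abs_of_nonneg (mul_nonneg (Real.rpow_nonneg (matNorm_nonneg _) _)
    (distBd_rpow_nonneg Ω x _))]
  exact hC x hx

lemma exists_distBd_le {n : ℕ} {Ω : Set (Euc n)} (hΩb : Bornology.IsBounded Ω) :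
    ∃ D, 0 ≤ D ∧ ∀ x ∈ Ω, distBd Ω x ≤ D := by
  obtain ⟨D, hD⟩ := hΩb.isCompact_closure.exists_bound_of_continuousOn
    (continuous_distBd Ω).continuousOn
  exact ⟨max D 0, le_max_right _ _, fun x hx =>
    (le_abs_self _).trans ((hD x (subset_closure hx)).trans (le_max_left _ _))⟩

lemma MemWeightedLq.integrableOn_matNorm {n : ℕ} (hn : 3 ≤ n) {Ω : Set (Euc n)}
    (hΩo : IsOpen Ω) (hΩb : Bornology.IsBounded Ω) {q β : ℝ} (hq : 1 ≤ q) (hβ : 0 ≤ β)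
    {G : Euc n → Matrix (Fin n) (Fin n) ℝ} (hG : MemWeightedLq Ω q β G) :
    IntegrableOn (fun x => matNorm (G x)) Ω := by
  obtain ⟨D, hD0, hD⟩ := exists_distBd_le hΩb
  have h1 : IntegrableOn (fun _ : Euc n => (1 : ℝ)) Ω :=
    integrableOn_of_bound hΩo hΩb aestronglyMeasurable_const 1 (by simp)
  refine Integrable.mono' (h1.add (hG.2.const_mul (D ^ (q * β))))
    (continuous_matNorm.comp_aestronglyMeasurable hG.1) ?_
  filter_upwards [ae_restrict_mem hΩo.measurableSet] with x hx
  have hρ := distBd_pos hn hΩo hΩb hx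
  have hN := matNorm_nonneg (G x)
  rw [Real.norm_of_nonneg hN]
  have hle : matNorm (G x) ≤ 1 + matNorm (G x) ^ q := by
    rcases le_total (matNorm (G x)) 1 with h | h
    · linarith [Real.rpow_nonneg hN q]
    · linarith [Real.self_le_rpow_of_one_le h hq]
  refine hle.trans (add_le_add_right ?_ 1)
  have hW : distBd Ω x ^ (q * β) * distBd Ω x ^ (-(q * β)) = 1 := by
    rw [← Real.rpow_add hρ, add_neg_cancel, Real.rpow_zero]
  calc matNorm (G x) ^ q
      = distBd Ω x ^ (q * β) * (matNorm (G x) ^ q * distBd Ω x ^ (-(q * β))) := by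
        linear_combination (-(matNorm (G x) ^ q)) * hW
    _ ≤ D ^ (q * β) * (matNorm (G x) ^ q * distBd Ω x ^ (-(q * β))) := by
        refine mul_le_mul_of_nonneg_right (Real.rpow_le_rpow hρ.le (hD x hx) (by positivity)) ?_
        exact mul_nonneg (Real.rpow_nonneg hN _) (distBd_rpow_nonneg Ω x _)

lemma exists_pairing {n : ℕ} {Ω : Set (Euc n)} (hΩo : IsOpen Ω)
    (hΩb : Bornology.IsBounded Ω) {G : Euc n → Matrix (Fin n) (Fin n) ℝ}
    (hG : AEStronglyMeasurable G (volume.restrict Ω))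
    (hGi : IntegrableOn (fun x => matNorm (G x)) Ω) :
    ∃ ℓ : Module.Dual ℝ (Vsub n), ∀ φ : Vsub n, ℓ φ = ∫ x in Ω, matDot (G x) (φ.1 x) := by
  have hint := fun φ : Vsub n => integrableOn_matDot hΩo hΩb hG hGi φ.2
  refine ⟨⟨⟨fun φ => ∫ x in Ω, matDot (G x) (φ.1 x), fun φ φ' => ?_⟩, fun a φ => ?_⟩,
    fun φ => rfl⟩
  · rw [← integral_add (hint φ) (hint φ')]
    refine integral_congr_ae (.of_forall fun x => ?_)
    simp only [Submodule.coe_add, Pi.add_apply, matDot_comm (G x), matDot_add_left]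
  · simp only [RingHom.id_apply]
    rw [smul_eq_mul, ← integral_const_mul]
    refine integral_congr_ae (.of_forall fun x => ?_)
    simp only [Submodule.coe_smul, Pi.smul_apply, matDot_comm (G x), matDot_smul_left]

lemma memWeightedLq_rpow_smul {n : ℕ} (hn : 3 ≤ n) {Ω : Set (Euc n)} (hΩo : IsOpen Ω)
    (hΩb : Bornology.IsBounded Ω) {p q β : ℝ} (hp : 1 ≤ p) (hq : 0 ≤ q) (hβ : 0 ≤ β)
    {ψ : Euc n → Matrix (Fin n) (Fin n) ℝ} (hψ : ψ ∈ Vsub n) :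
    MemWeightedLq Ω q β (fun x => distBd Ω x ^ (p * β) • ψ x) := by
  obtain ⟨C, hC0, hC⟩ := exists_matNorm_le_of_mem_Vsub hψ hΩb
  obtain ⟨D, hD0, hD⟩ := exists_distBd_le hΩb
  have hexp : 0 ≤ p * β * q + -(q * β) := by
    have : 0 ≤ (p - 1) * (β * q) := mul_nonneg (by linarith) (by positivity)
    linarith
  refine memWeightedLq_of_bound hΩo hΩb hq ?_ (D ^ (p * β * q + -(q * β)) * C ^ q)
    fun x hx => ?_
  · have h1 : Continuous fun x => distBd Ω x ^ (p * β) :=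
      (continuous_distBd Ω).rpow_const fun _ => Or.inr (by positivity)
    exact (h1.smul (continuous_of_mem_Vsub hψ)).aestronglyMeasurable
  · have hρ := distBd_pos hn hΩo hΩb hx
    have hN := matNorm_nonneg (ψ x)
    calc matNorm (distBd Ω x ^ (p * β) • ψ x) ^ q * distBd Ω x ^ (-(q * β))
        = distBd Ω x ^ (p * β * q + -(q * β)) * matNorm (ψ x) ^ q := by
          rw [matNorm_smul, abs_of_nonneg (distBd_rpow_nonneg Ω x _),
            Real.mul_rpow (distBd_rpow_nonneg Ω x _) hN, ← Real.rpow_mul hρ.le,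
            Real.rpow_add hρ]
          ring
      _ ≤ _ := by
          refine mul_le_mul (Real.rpow_le_rpow hρ.le (hD x hx) hexp)
            (Real.rpow_le_rpow hN (hC x hx) hq) (Real.rpow_nonneg hN _) (by positivity)

lemma memWeightedLq_indicator_of_mem_Vsub {n : ℕ} {Ω : Set (Euc n)} (hΩo : IsOpen Ω)
    (hΩb : Bornology.IsBounded Ω) {q β : ℝ} (hq : 0 < q) (hβ : 0 ≤ β)
    {K : Set (Euc n)} (hK : MeasurableSet K) {δ : ℝ} (hδ : 0 < δ)
    (hKδ : ∀ x ∈ K, δ ≤ distBd Ω x) {v : Euc n → Matrix (Fin n) (Fin n) ℝ}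
    (hv : v ∈ Vsub n) : MemWeightedLq Ω q β (K.indicator v) := by
  obtain ⟨C, hC0, hC⟩ := exists_matNorm_le_of_mem_Vsub hv hΩb
  refine memWeightedLq_of_bound hΩo hΩb hq.le
    ((continuous_of_mem_Vsub hv).aestronglyMeasurable.indicator hK)
    (C ^ q * δ ^ (-(q * β))) fun x hx => ?_
  by_cases hxK : x ∈ K
  · rw [indicator_of_mem hxK]
    exact mul_le_mul (Real.rpow_le_rpow (matNorm_nonneg _) (hC x hx) hq.le)
      (Real.rpow_le_rpow_of_nonpos hδ (hKδ x hxK) (by simp; positivity))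
      (distBd_rpow_nonneg Ω x _) (by positivity)
  · rw [indicator_of_notMem hxK, matNorm_zero, Real.zero_rpow hq.ne', zero_mul]
    positivity

lemma matNorm_map_le {n : ℕ} (T : Module.Dual ℝ (Vsub n) →ₗ[ℝ] Vsub n) {Ω : Set (Euc n)}
    (hΩb : Bornology.IsBounded Ω) :
    ∃ (d : ℕ) (φ : Fin d → Vsub n) (A : ℝ), 0 ≤ A ∧
      ∀ ℓ : Module.Dual ℝ (Vsub n), ∀ x ∈ Ω, matNorm ((T ℓ).1 x) ≤ A * ∑ j, |ℓ (φ j)| := by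
  let b := Module.finBasis ℝ (Vsub n)
  choose A hA0 hA using fun j => exists_matNorm_le_of_mem_Vsub (T (b.coord j)).2 hΩb
  refine ⟨_, b, ∑ j, A j, Finset.sum_nonneg fun j _ => hA0 j, fun ℓ x hx => ?_⟩
  have hT : (T ℓ).1 x = ∑ j, ℓ (b j) • (T (b.coord j)).1 x := by
    have h := congrArg T (b.sum_dual_apply_smul_coord ℓ).symm
    simp only [map_sum, map_smul] at h
    rw [h, Submodule.coe_sum, Finset.sum_apply]
    rfl
  rw [hT, Finset.mul_sum]
  refine (matNorm_sum_le _ _).trans (Finset.sum_le_sum fun j _ => ?_)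
  rw [matNorm_smul, mul_comm]
  refine mul_le_mul_of_nonneg_right ((hA j x hx).trans ?_) (abs_nonneg _)
  exact Finset.single_le_sum (fun i _ => hA0 i) (Finset.mem_univ j)

/-- A field of `W` is a limit of fields of `W₀`. -/
lemma exists_memW0_tendsto {n : ℕ} (hn : 3 ≤ n) {Ω : Set (Euc n)} (hΩo : IsOpen Ω)
    (hΩne : Ω.Nonempty) (hΩb : Bornology.IsBounded Ω) {q β : ℝ} (hq : 1 ≤ q) (hβ : 0 ≤ β)
    {Γ : Type} (wd : WhitneyDecomp n Ω Γ) {G : Euc n → Matrix (Fin n) (Fin n) ℝ}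
    (hG : MemWeightedLq Ω q β G)
    (hGV : ∀ φ : Vsub n, ∫ x in Ω, matDot (G x) (φ.1 x) = 0) :
    ∃ g : ℕ → Euc n → Matrix (Fin n) (Fin n) ℝ, (∀ m, memW0 q β wd (g m)) ∧
      Filter.Tendsto (fun m => ∫ x in Ω, matNorm (G x - g m x) ^ q *
        distBd Ω x ^ (-(q * β))) Filter.atTop (nhds 0) := by
  have hq0 : 0 < q := by linarith
  obtain ⟨x₀, hx₀⟩ := hΩne
  set δ : ℝ := distBd Ω x₀ / 2 with hδdef
  have hρ₀ := distBd_pos hn hΩo hΩb hx₀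
  have hδ : 0 < δ := by positivity
  let K : ℕ → Set (Euc n) := fun m => {x | x ∈ Ω ∧ δ / (m + 1) ≤ distBd Ω x}
  have hKm : ∀ m, MeasurableSet (K m) := fun m =>
    hΩo.measurableSet.inter (measurableSet_le measurable_const (continuous_distBd Ω).measurable)
  have hK0 : ∀ m, K 0 ⊆ K m := fun m x hx => ⟨hx.1, le_trans (by
    simp only [Nat.cast_zero, zero_add, div_one]
    exact div_le_self hδ.le (by simp)) hx.2⟩
  have hKev : ∀ x ∈ Ω, ∀ᶠ m in Filter.atTop, x ∈ K m := by
    intro x hx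
    have ht : Filter.Tendsto (fun m : ℕ => δ / ((m : ℝ) + 1)) Filter.atTop (nhds 0) :=
      tendsto_const_div_atTop_nhds_zero_nat δ |>.comp (Filter.tendsto_add_atTop_nat 1) |>.congr
        fun m => by simp
    filter_upwards [ht.eventually_lt_const (distBd_pos hn hΩo hΩb hx)] with m hm
    exact ⟨hx, hm.le⟩
  have hU : IsOpen {x | x ∈ Ω ∧ δ < distBd Ω x} :=
    hΩo.inter (isOpen_lt continuous_const (continuous_distBd Ω))
  have hUK : ∀ x ∈ {x | x ∈ Ω ∧ δ < distBd Ω x}, x ∈ K 0 := fun x hx =>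
    ⟨hx.1, by simpa using hx.2.le⟩
  obtain ⟨T, hT⟩ := exists_weighted_representation_map hΩo hΩb hU
    ⟨x₀, hx₀, by rw [hδdef]; linarith⟩ (fun x hx => hx.1)
    (w := (K 0).indicator fun _ => 1)
    ((measurable_const.indicator (hKm 0)).aestronglyMeasurable) 1
    (fun x _ => indicator_nonneg (fun _ _ => zero_le_one) x)
    (fun x _ => indicator_le_self' (fun _ _ => zero_le_one) x)
    (fun x hx => by rw [indicator_of_mem (hUK x hx)]; exact one_pos)
  have hGK : ∀ m, MemWeightedLq Ω q β ((K m).indicator G) := fun m =>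
    hG.indicator hq0.le (hKm m)
  choose ℓ hℓ using fun m => exists_pairing hΩo hΩb (hGK m).1
    ((hGK m).integrableOn_matNorm hn hΩo hΩb hq hβ)
  have hv : ∀ m, MemWeightedLq Ω q β ((K 0).indicator (T (ℓ m)).1) := fun m =>
    memWeightedLq_indicator_of_mem_Vsub hΩo hΩb hq0 hβ (hKm 0) hδ
      (fun x hx => by simpa using hx.2) (T (ℓ m)).2
  let g : ℕ → Euc n → Matrix (Fin n) (Fin n) ℝ := fun m =>
    (K m).indicator G - (K 0).indicator (T (ℓ m)).1
  have hg : ∀ m, MemWeightedLq Ω q β (g m) := fun m => (hGK m).sub hq0.le (hv m)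
  have hℓ0 : ∀ φ : Vsub n, Filter.Tendsto (fun m => ℓ m φ) Filter.atTop (nhds 0) := by
    intro φ
    rw [← hGV φ]
    simp only [hℓ]
    have hGi := integrableOn_matDot hΩo hΩb hG.1
      (hG.integrableOn_matNorm hn hΩo hΩb hq hβ) φ.2
    refine tendsto_integral_of_dominated_convergence
      (fun x => ‖matDot (G x) (φ.1 x)‖) (fun m => ?_) hGi.norm (fun m => ?_) ?_
    · exact (integrableOn_matDot hΩo hΩb (hGK m).1
        ((hGK m).integrableOn_matNorm hn hΩo hΩb hq hβ) φ.2).aestronglyMeasurable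
    · refine .of_forall fun x => ?_
      by_cases hx : x ∈ K m
      · rw [indicator_of_mem hx]
      · rw [indicator_of_notMem hx]
        simp [matDot]
    · filter_upwards [ae_restrict_mem hΩo.measurableSet] with x hx
      refine tendsto_const_nhds.congr' ?_
      filter_upwards [hKev x hx] with m hm
      rw [indicator_of_mem hm]
  obtain ⟨d, b, A, hA0, hA⟩ := matNorm_map_le T hΩb
  set a : ℕ → ℝ := fun m => A * ∑ j, |ℓ m (b j)| with ha
  have ha0 : Filter.Tendsto a Filter.atTop (nhds 0) := by
    have h : Filter.Tendsto a Filter.atTop (nhds (A * ∑ _j : Fin d, |(0 : ℝ)|)) :=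
      (tendsto_finsetSum _ fun j _ => (hℓ0 (b j)).abs).const_mul A
    simpa using h
  obtain ⟨M, hM⟩ := ha0.bddAbove_range
  have haM : ∀ m, a m ≤ M := fun m => hM ⟨m, rfl⟩
  have han : ∀ m, 0 ≤ a m := fun m =>
    mul_nonneg hA0 (Finset.sum_nonneg fun j _ => abs_nonneg _)
  refine ⟨g, fun m => ⟨⟨(hg m).1, (hg m).integrableOn_matNorm hn hΩo hΩb hq hβ, (hg m).2,
    fun φ hφ => ?_⟩, ?_⟩, ?_⟩
  · have hφ' := mem_Vsub_iff.mpr hφ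
    have h1 := integrableOn_matDot hΩo hΩb (hGK m).1
      ((hGK m).integrableOn_matNorm hn hΩo hΩb hq hβ) hφ'
    have h2 := integrableOn_matDot hΩo hΩb (hv m).1
      ((hv m).integrableOn_matNorm hn hΩo hΩb hq hβ) hφ'
    have h3 : ∫ x in Ω, matDot ((K 0).indicator (T (ℓ m)).1 x) (φ x) = ℓ m ⟨φ, hφ'⟩ := by
      rw [← hT (ℓ m) ⟨φ, hφ'⟩]
      refine integral_congr_ae (.of_forall fun x => ?_)
      by_cases hx : x ∈ K 0
      · simp [hx]
      · simp [hx, matDot]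
    simp only [g, Pi.sub_apply, matDot_sub_left]
    rw [integral_sub h1 h2, h3, hℓ, sub_self]
  · refine finite_extCube_of_le_distBd hΩb wd (δ := δ / (m + 1)) (by positivity) fun x hx => ?_
    by_contra hlt
    have hxK : x ∉ K m := fun h => hlt h.2
    have hxK0 : x ∉ K 0 := fun h => hxK (hK0 m h)
    exact hx (by simp [g, hxK, hxK0])
  · have hzero : (0 : ℝ) = ∫ _x in Ω, (0 : ℝ) := by simp
    rw [hzero]
    have hr : ∀ m, ∀ x ∈ Ω, matNorm ((K 0).indicator (T (ℓ m)).1 x) ≤ a m := fun m x hx =>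
      (matNorm_indicator_le _ _ _).trans (hA (ℓ m) x hx)
    have hGin : ∀ m, ∀ x ∈ K m, G x - g m x = (K 0).indicator (T (ℓ m)).1 x := by
      intro m x hx
      simp [g, hx]
    have hbound : ∀ m, ∀ x ∈ Ω, matNorm (G x - g m x) ^ q * distBd Ω x ^ (-(q * β)) ≤
        matNorm (G x) ^ q * distBd Ω x ^ (-(q * β)) + M ^ q * δ ^ (-(q * β)) := by
      intro m x hx
      have hM0 : 0 ≤ M := (han m).trans (haM m)
      have hrM := (hr m x hx).trans (haM m)
      have hnn : 0 ≤ matNorm (G x) ^ q * distBd Ω x ^ (-(q * β)) :=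
        mul_nonneg (Real.rpow_nonneg (matNorm_nonneg _) _) (distBd_rpow_nonneg Ω x _)
      have hMδ : 0 ≤ M ^ q * δ ^ (-(q * β)) := by positivity
      by_cases hx0 : x ∈ K 0
      · rw [hGin m x (hK0 m hx0)]
        refine le_trans (mul_le_mul (Real.rpow_le_rpow (matNorm_nonneg _) hrM hq0.le)
          (Real.rpow_le_rpow_of_nonpos hδ (by simpa using hx0.2) ?_)
          (distBd_rpow_nonneg Ω x _) (by positivity)) (le_add_of_nonneg_left hnn)
        exact neg_nonpos.mpr (by positivity)
      · by_cases hxm : x ∈ K m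
        · rw [hGin m x hxm, indicator_of_notMem hx0, matNorm_zero, Real.zero_rpow hq0.ne',
            zero_mul]
          positivity
        · have : g m x = 0 := by simp [g, hx0, hxm]
          rw [this, sub_zero]
          exact le_add_of_nonneg_right hMδ
    refine tendsto_integral_of_dominated_convergence
      (fun x => matNorm (G x) ^ q * distBd Ω x ^ (-(q * β)) + M ^ q * δ ^ (-(q * β)))
      (fun m => aestronglyMeasurable_weighted β hq0.le (hG.1.sub (hg m).1))
      (hG.2.add (integrableOn_of_bound hΩo hΩb aestronglyMeasurable_const _
        fun x _ => le_rfl)) (fun m => ?_) ?_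
    · filter_upwards [ae_restrict_mem hΩo.measurableSet] with x hx
      rw [Real.norm_of_nonneg (mul_nonneg (Real.rpow_nonneg (matNorm_nonneg _) _)
        (distBd_rpow_nonneg Ω x _))]
      exact hbound m x hx
    · filter_upwards [ae_restrict_mem hΩo.measurableSet] with x hx
      have hlim : Filter.Tendsto (fun m => a m ^ q * distBd Ω x ^ (-(q * β)))
          Filter.atTop (nhds 0) := by
        have h := (ha0.rpow_const (p := q) (Or.inr hq0.le)).mul_const
          (distBd Ω x ^ (-(q * β)))
        simpa [Real.zero_rpow hq0.ne'] using h
      refine squeeze_zero' (.of_forall fun m => mul_nonneg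
        (Real.rpow_nonneg (matNorm_nonneg _) _) (distBd_rpow_nonneg Ω x _)) ?_ hlim
      filter_upwards [hKev x hx] with m hm
      rw [hGin m x hm]
      exact mul_le_mul_of_nonneg_right
        (Real.rpow_le_rpow (matNorm_nonneg _) (hr m x hx) hq0.le) (distBd_rpow_nonneg Ω x _)

/-- the subspace `S = W₀ ⊕ ρ^{pβ}V` is dense in `L^q(Ω, ℝ^{n×n}, ρ^{−β})`. -/
theorem S_dense_in_weighted_Lq
    {n : ℕ} (hn : 3 ≤ n) (Ω : Set (Euc n)) (hΩo : IsOpen Ω) (hΩc : IsConnected Ω)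
    (hΩb : Bornology.IsBounded Ω) (hJ : IsJohnDomain Ω)
    (p q β : ℝ) (hp1 : 1 < p) (hq1 : 1 < q) (hpq : 1 / p + 1 / q = 1) (hβ : 0 ≤ β)
    (Γ : Type) (wd : WhitneyDecomp n Ω Γ) :
    ∀ F : Euc n → Matrix (Fin n) (Fin n) ℝ,
      AEStronglyMeasurable F (volume.restrict Ω) →
      IntegrableOn (fun x => matNorm (F x) ^ q * distBd Ω x ^ (-(q * β))) Ω →
      ∀ ε : ℝ, 0 < ε →
        ∃ (g ψ : Euc n → Matrix (Fin n) (Fin n) ℝ), memW0 q β wd g ∧ ψ ∈ Vset n ∧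
          (∫ x in Ω, matNorm (F x - (g x + distBd Ω x ^ (p * β) • ψ x)) ^ q *
              distBd Ω x ^ (-(q * β))) ^ (1 / q) < ε := by

  intro F hF hFi ε hε
  have hq0 : 0 < q := by linarith
  have hFm : MemWeightedLq Ω q β F := ⟨hF, hFi⟩
  obtain ⟨D, hD0, hD⟩ := exists_distBd_le hΩb
  have hpβ : 0 ≤ p * β := mul_nonneg (by linarith) hβ
  obtain ⟨T, hT⟩ := exists_weighted_representation_map hΩo hΩb hΩo hΩc.nonempty subset_rfl
    (w := fun x => distBd Ω x ^ (p * β))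
    ((continuous_distBd Ω).measurable.pow_const _).aestronglyMeasurable (D ^ (p * β))
    (fun x _ => distBd_rpow_nonneg Ω x _)
    (fun x hx => Real.rpow_le_rpow Metric.infDist_nonneg (hD x hx) hpβ)
    (fun x hx => Real.rpow_pos_of_pos (distBd_pos hn hΩo hΩb hx) _)
  have hF1 := hFm.integrableOn_matNorm hn hΩo hΩb hq1.le hβ
  obtain ⟨ℓ, hℓ⟩ := exists_pairing hΩo hΩb hF hF1
  set ψ : Euc n → Matrix (Fin n) (Fin n) ℝ := (T ℓ).1 with hψ
  have hψw : MemWeightedLq Ω q β (fun x => distBd Ω x ^ (p * β) • ψ x) :=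
    memWeightedLq_rpow_smul hn hΩo hΩb hp1.le hq0.le hβ (T ℓ).2
  have hψ1 := hψw.integrableOn_matNorm hn hΩo hΩb hq1.le hβ
  obtain ⟨g, hgW, hg⟩ := exists_memW0_tendsto hn hΩo hΩc.nonempty hΩb hq1.le hβ wd
    (hFm.sub hq0.le hψw) (fun φ => by
      simp only [Pi.sub_apply, matDot_sub_left]
      rw [integral_sub (integrableOn_matDot hΩo hΩb hF hF1 φ.2)
        (integrableOn_matDot hΩo hΩb hψw.1 hψ1 φ.2), ← hℓ, ← hT ℓ φ]
      simp only [matDot_smul_left, hψ, sub_self])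
  have hlim := hg.rpow_const (p := 1 / q) (Or.inr (by positivity))
  rw [Real.zero_rpow (by positivity)] at hlim
  obtain ⟨m, hm⟩ := (hlim.eventually_lt_const hε).exists
  refine ⟨g m, ψ, hgW m, mem_Vsub_iff.mp (T ℓ).2, ?_⟩
  have hx : ∀ x, F x - (g m x + distBd Ω x ^ (p * β) • ψ x) =
      (F - fun x => distBd Ω x ^ (p * β) • ψ x) x - g m x := fun x =>
    sub_add_eq_sub_sub_swap _ _ _
  simpa only [hx] using hm

end
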